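/- If T(x) ≠ x for some state x ∈ S^N, then E(T(x)) < E(x). That is, the energy of the complex-valued multistate recurrent correlation neural network strictly decreases at every non-stationary synchronous update. -/

import Mathlib

open scoped Classical

/-- The argument of a complex number taken in `[0, 2π)`. -/
noncomputable def arg2pi (z : ℂ) : ℝ :=
  if Complex.arg z < 0 then Complex.arg z + 2 * Real.pi else Complex.arg z

/-- The domain `D` of the complex-valued multistate signum function: nonzero complex
numbers whose argument (in `[0, 2π)`) differs from `(2k-1)·Δθ` for all `k = 1,…,K`,
where `Δθ = π/K`. -/
def Dset (K : ℕ) : Set ℂ :=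
  {z | z ≠ 0 ∧ ∀ k : ℕ, 1 ≤ k → k ≤ K → arg2pi z ≠ (2 * (k : ℝ) - 1) * (Real.pi / K)}

/-- The set `S = {e^{2kΔθ·i} : k = 0,…,K-1}` of `K`-th roots of unity, `Δθ = π/K`. -/
def Sset (K : ℕ) : Set ℂ :=
  {s | ∃ k : ℕ, k < K ∧ s = Complex.exp ((2 * (k : ℝ) * (Real.pi / K) : ℝ) * Complex.I)}

/-- `csgn` is a complex-valued multistate signum function with resolution factor `K`:
for every `z ∈ D`, `csgn z` is the element `s ∈ S` such that the argument of
`z · conj s` lies in the open interval `(-Δθ, Δθ)` modulo `2π`. -/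
def IsCsgn (K : ℕ) (csgn : ℂ → ℂ) : Prop :=
  ∀ z ∈ Dset K, csgn z ∈ Sset K ∧
    Complex.arg (z * (starRingEnd ℂ) (csgn z)) ∈ Set.Ioo (-(Real.pi / K)) (Real.pi / K)

/-- Correlation `Σ_i Re(conj(u_i^ξ)·x_i)` of a state with the `ξ`-th fundamental memory. -/
noncomputable def cOverlap {N P : ℕ} (u : Fin P → Fin N → ℂ) (x : Fin N → ℂ) (ξ : Fin P) : ℝ :=
  ∑ i, ((starRingEnd ℂ) (u ξ i) * x i).re

/-- Activation potential `h_i(x) = Σ_ξ w_ξ(x)·u_i^ξ` with `w_ξ(x) = f(cOverlap u x ξ)`. -/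
noncomputable def cPot {N P : ℕ} (f : ℝ → ℝ) (u : Fin P → Fin N → ℂ) (x : Fin N → ℂ)
    (i : Fin N) : ℂ :=
  ∑ ξ, (f (cOverlap u x ξ) : ℂ) * u ξ i

/-- Energy of the complex-valued recurrent correlation neural network. -/
noncomputable def cEnergy {N P : ℕ} (F : ℝ → ℝ) (u : Fin P → Fin N → ℂ) (x : Fin N → ℂ) : ℝ :=
  -∑ ξ, F (cOverlap u x ξ)

/-- Synchronous update of the complex-valued multistate RCNN. -/
noncomputable def cUpd (K : ℕ) (csgn : ℂ → ℂ) {N P : ℕ} (f : ℝ → ℝ)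
    (u : Fin P → Fin N → ℂ) (x : Fin N → ℂ) : Fin N → ℂ :=
  fun i => if cPot f u x i ∈ Dset K then csgn (cPot f u x i) else x i

theorem aux_sin (K : ℕ) (hK : 1 < K) (φ : ℝ) (h1 : -(Real.pi / K) < φ) (h2 : φ < Real.pi / K)
    (m : ℝ) (hm : 1 ≤ m) (hm2 : m ≤ K - 1) :
    0 < Real.sin (m * (Real.pi / K)) * Real.sin (m * (Real.pi / K) - φ) := by
  have hK0 : (0 : ℝ) < K := by positivity
  have hd : 0 < Real.pi / K := by positivity
  have hpi : (K : ℝ) * (Real.pi / K) = Real.pi := by field_simp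
  have a1 : Real.pi / K ≤ m * (Real.pi / K) := by nlinarith
  have a2 : m * (Real.pi / K) ≤ Real.pi - Real.pi / K := by nlinarith
  apply mul_pos <;> apply Real.sin_pos_of_pos_of_lt_pi <;> linarith

theorem aux_cos (K : ℕ) (hK : 1 < K) (φ : ℝ) (h1 : -(Real.pi / K) < φ) (h2 : φ < Real.pi / K)
    (a b : ℕ) (ha : a < K) (hb : b < K) (hab : a ≠ b) :
    Real.cos (2 * (a : ℝ) * (Real.pi / K) - 2 * (b : ℝ) * (Real.pi / K) - φ) < Real.cos φ := by
  have key : Real.cos φ - Real.cos (2 * (a : ℝ) * (Real.pi / K) - 2 * (b : ℝ) * (Real.pi / K) - φ)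
      = 2 * (Real.sin (((a : ℝ) - b) * (Real.pi / K))
        * Real.sin (((a : ℝ) - b) * (Real.pi / K) - φ)) := by
    rw [Real.cos_sub_cos]
    have e1 : (φ + (2 * (a : ℝ) * (Real.pi / K) - 2 * (b : ℝ) * (Real.pi / K) - φ)) / 2
      = ((a : ℝ) - b) * (Real.pi / K) := by ring
    have e2 : (φ - (2 * (a : ℝ) * (Real.pi / K) - 2 * (b : ℝ) * (Real.pi / K) - φ)) / 2
      = -(((a : ℝ) - b) * (Real.pi / K) - φ) := by ring
    rw [e1, e2, Real.sin_neg]; ring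
  rcases lt_or_gt_of_ne hab with h | h
  · have c1 : (a : ℝ) + 1 ≤ b := by exact_mod_cast h
    have c2 : (b : ℝ) + 1 ≤ K := by exact_mod_cast hb
    have c3 : (0 : ℝ) ≤ a := by positivity
    have := aux_sin K hK (-φ) (by linarith) (by linarith) ((b : ℝ) - a) (by linarith) (by linarith)
    have e1 : ((a : ℝ) - b) * (Real.pi / K) = -(((b : ℝ) - a) * (Real.pi / K)) := by ring
    have e2 : ((a : ℝ) - b) * (Real.pi / K) - φ = -(((b : ℝ) - a) * (Real.pi / K) - -φ) := by ring
    rw [e2, e1, Real.sin_neg, Real.sin_neg] at key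
    linarith
  · have c1 : (b : ℝ) + 1 ≤ a := by exact_mod_cast h
    have c2 : (a : ℝ) + 1 ≤ K := by exact_mod_cast ha
    have c3 : (0 : ℝ) ≤ b := by positivity
    have := aux_sin K hK φ h1 h2 ((a : ℝ) - b) (by linarith) (by linarith)
    linarith

theorem aux_key (K : ℕ) (hK : 1 < K) (z s t : ℂ) (hz : z ≠ 0) (hs : s ∈ Sset K) (ht : t ∈ Sset K)
    (hst : t ≠ s)
    (h : Complex.arg (z * (starRingEnd ℂ) s) ∈ Set.Ioo (-(Real.pi / K)) (Real.pi / K)) :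
    ((starRingEnd ℂ) z * t).re < ((starRingEnd ℂ) z * s).re := by
  obtain ⟨b, hb, hsb⟩ := hs
  obtain ⟨a, ha, hta⟩ := ht
  have hab : a ≠ b := by rintro rfl; exact hst (hta.trans hsb.symm)
  have hc := aux_cos K hK _ h.1 h.2 a b ha hb hab
  set α : ℝ := 2 * (a : ℝ) * (Real.pi / K) with hα
  set β : ℝ := 2 * (b : ℝ) * (Real.pi / K) with hβ
  set w := z * (starRingEnd ℂ) s with hw
  have hss : (starRingEnd ℂ) s * s = 1 := by
    rw [hsb, ← Complex.exp_conj, ← Complex.exp_add]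
    simp
  have hs0 : (starRingEnd ℂ) s ≠ 0 := left_ne_zero_of_mul_eq_one hss
  have hw0 : 0 < ‖w‖ := norm_pos_iff.mpr (mul_ne_zero hz hs0)
  have hzw : z = w * s := by rw [hw, mul_assoc, hss, mul_one]
  have hpol : w = ‖w‖ * Complex.exp (Complex.arg w * Complex.I) :=
    (Complex.norm_mul_exp_arg_mul_I w).symm
  have hcz : ∀ γ : ℝ, ((starRingEnd ℂ) z * Complex.exp (γ * Complex.I)).re
      = ‖w‖ * Real.cos (γ - β - Complex.arg w) := by
    intro γ
    have : (starRingEnd ℂ) z * Complex.exp (γ * Complex.I)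
        = (‖w‖ : ℂ) * Complex.exp (((γ - β - Complex.arg w : ℝ) : ℂ) * Complex.I) := by
      have hcw : (starRingEnd ℂ) w = ‖w‖ * Complex.exp (-(Complex.arg w * Complex.I)) := by
        conv_lhs => rw [hpol]
        rw [map_mul, ← Complex.exp_conj]
        simp
      have hcs : (starRingEnd ℂ) s = Complex.exp (-(β * Complex.I)) := by
        rw [hsb, ← Complex.exp_conj]
        simp
      rw [hzw, map_mul, hcw, hcs, mul_assoc, mul_assoc, ← Complex.exp_add, ← Complex.exp_add]
      congr 2
      push_cast
      ring
    rw [this, Complex.re_ofReal_mul, Complex.exp_ofReal_mul_I_re]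
  rw [hta, hcz α, hsb, hcz β]
  have : Real.cos (β - β - Complex.arg w) = Real.cos (Complex.arg w) := by
    rw [sub_self, zero_sub, Real.cos_neg]
  rw [this]
  exact mul_lt_mul_of_pos_left hc hw0

theorem aux_convex (f F : ℝ → ℝ) (hmono : Monotone f)
    (hF : ∀ t : ℝ, HasDerivAt F (f t) t) (a b : ℝ) : f a * (b - a) ≤ F b - F a := by
  have hd : Differentiable ℝ F := fun t => (hF t).differentiableAt
  have hc : Continuous F := hd.continuous
  rcases lt_trichotomy a b with h | h | h
  · obtain ⟨c, hc1, hc2⟩ := exists_hasDerivAt_eq_slope F f h hc.continuousOn (fun t _ => hF t)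
    have : f a ≤ f c := hmono hc1.1.le
    rw [eq_div_iff (by linarith)] at hc2
    nlinarith
  · subst h; simp
  · obtain ⟨c, hc1, hc2⟩ := exists_hasDerivAt_eq_slope F f h hc.continuousOn (fun t _ => hF t)
    have : f c ≤ f a := hmono hc1.2.le
    rw [eq_div_iff (by linarith)] at hc2
    nlinarith

theorem aux_swap {N P : ℕ} (f : ℝ → ℝ) (u : Fin P → Fin N → ℂ) (x y : Fin N → ℂ) :
    ∑ ξ, f (cOverlap u x ξ) * cOverlap u y ξ
      = ∑ i, ((starRingEnd ℂ) (cPot f u x i) * y i).re := by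
  have : ∀ i, ((starRingEnd ℂ) (cPot f u x i) * y i).re
      = ∑ ξ, f (cOverlap u x ξ) * ((starRingEnd ℂ) (u ξ i) * y i).re := by
    intro i
    rw [cPot, map_sum, Finset.sum_mul, Complex.re_sum]
    refine Finset.sum_congr rfl fun ξ _ => ?_
    rw [map_mul, Complex.conj_ofReal, mul_assoc, Complex.re_ofReal_mul]
  simp_rw [this]
  rw [Finset.sum_comm]
  refine Finset.sum_congr rfl fun ξ _ => ?_
  conv_lhs => rw [cOverlap.eq_def u y, Finset.mul_sum]

/-- The energy of the complex-valued multistate RCNN strictly decreases at every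
non-stationary synchronous update. -/
theorem complex_multistate_energy_decreases_sync (K : ℕ) (hK : 1 < K)
    (csgn : ℂ → ℂ) (hcsgn : IsCsgn K csgn)
    {N P : ℕ} (hN : 1 ≤ N) (hP : 1 ≤ P)
    (f F : ℝ → ℝ) (hf : Continuous f) (hmono : Monotone f)
    (hF : ∀ t : ℝ, HasDerivAt F (f t) t)
    (u : Fin P → Fin N → ℂ) (hu : ∀ ξ i, u ξ i ∈ Sset K)
    (x : Fin N → ℂ) (hx : ∀ i, x i ∈ Sset K)
    (hne : cUpd K csgn f u x ≠ x) :
    cEnergy F u (cUpd K csgn f u x) < cEnergy F u x := by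
  set y := cUpd K csgn f u x with hy
  have hlt : ∀ i, y i ≠ x i → ((starRingEnd ℂ) (cPot f u x i) * x i).re
      < ((starRingEnd ℂ) (cPot f u x i) * y i).re := by
    intro i hi
    by_cases hD : cPot f u x i ∈ Dset K
    · have hyi : y i = csgn (cPot f u x i) := by simp [hy, cUpd, hD]
      rw [hyi] at hi ⊢
      exact aux_key K hK _ _ _ hD.1 (hcsgn _ hD).1 (hx i) hi.symm (hcsgn _ hD).2
    · exact absurd (by simp [hy, cUpd, hD]) hi
  obtain ⟨j, hj⟩ := Function.ne_iff.mp hne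
  have hsum : ∑ i, ((starRingEnd ℂ) (cPot f u x i) * x i).re
      < ∑ i, ((starRingEnd ℂ) (cPot f u x i) * y i).re := by
    refine Finset.sum_lt_sum (fun i _ => ?_) ⟨j, Finset.mem_univ _, hlt j hj⟩
    by_cases h : y i = x i
    · rw [h]
    · exact (hlt i h).le
  rw [← aux_swap, ← aux_swap] at hsum
  have hconv : ∑ ξ, f (cOverlap u x ξ) * (cOverlap u y ξ - cOverlap u x ξ)
      ≤ ∑ ξ, (F (cOverlap u y ξ) - F (cOverlap u x ξ)) :=
    Finset.sum_le_sum fun ξ _ => aux_convex f F hmono hF _ _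
  simp only [mul_sub, Finset.sum_sub_distrib] at hconv
  unfold cEnergy
  linarith
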